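/- Let 0 < β < 1, let n ≥ 1, and let f ∈ C^n([0,∞)) be such that f and all of its derivatives up to order n are of exponential order. Assume that the k-fold Caputo derivative of f_β at 0⁺ matches the k-th derivative of f at 0, i.e. (D_c^β)^k f_β(0⁺) = f^{(k)}(0) for k = 0, 1, …, n−1. Then for every t > 0, the n-fold iterated Caputo derivative of the Wright-type transform of f satisfies (D_c^β)^n f_β(t) = ∫_0^∞ f^{(n)}(x) g_β(x;t) dx. -/

import Mathlib

open MeasureTheory Real Set Filter

/-- The Wright-type density `g_β(x;t) = t^{-β} ∑_{k} (−x/t^β)^k / (k! Γ(1 − β(k+1)))`. -/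
noncomputable def wrightG (β x t : ℝ) : ℝ :=
  t ^ (-β) * ∑' k : ℕ, (-x / t ^ β) ^ k / ((Nat.factorial k : ℝ) * Real.Gamma (1 - β * (k + 1)))

/-- The two-parameter Mittag-Leffler function `E_{β,α}(z) = ∑_k z^k / Γ(βk + α)`. -/
noncomputable def mittagLeffler (β α z : ℝ) : ℝ :=
  ∑' k : ℕ, z ^ k / Real.Gamma (β * k + α)

/-- The Caputo fractional derivative of order `β ∈ (0,1)`:
`D_c^β h(t) = (1/Γ(1−β)) ∫_0^t (t−τ)^{−β} h′(τ) dτ`. -/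
noncomputable def caputo (β : ℝ) (h : ℝ → ℝ) (t : ℝ) : ℝ :=
  (1 / Real.Gamma (1 - β)) * ∫ τ in (0:ℝ)..t, (t - τ) ^ (-β) * deriv h τ

/-- A function is of exponential order on `[0,∞)` if `|h(x)| ≤ C e^{a x}` there. -/
def ExpOrder (h : ℝ → ℝ) : Prop :=
  ∃ C a : ℝ, 0 < C ∧ 0 < a ∧ ∀ x : ℝ, 0 ≤ x → |h x| ≤ C * Real.exp (a * x)

/-- On `[0,∞)`, powers with bounded nonnegative exponent grow slower than any exponential. -/
lemma exists_rpow_le_exp (N : ℝ) {η : ℝ} (hη : 0 < η) :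
    ∃ C : ℝ, 0 < C ∧ ∀ p : ℝ, 0 ≤ p → p ≤ N → ∀ x : ℝ, 0 ≤ x →
      x ^ p ≤ C * Real.exp (η * x) := by
  set q : ℝ := |N| + 1 with hq
  have hq0 : 0 < q := by positivity
  refine ⟨(q / η) ^ q * Real.exp η, by positivity, fun p hp hpN x hx => ?_⟩
  have hpq : p ≤ q := by have := le_abs_self N; linarith
  have h1 : x ^ p ≤ (1 + x) ^ q :=
    (Real.rpow_le_rpow hx (by linarith) hp).trans
      (Real.rpow_le_rpow_of_exponent_le (by linarith) hpq)
  have h2 : 1 + x ≤ q / η * Real.exp (η * (1 + x) / q) := by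
    have := Real.add_one_le_exp (η * (1 + x) / q)
    calc 1 + x = q / η * (η * (1 + x) / q) := by field_simp
      _ ≤ _ := by gcongr; linarith
  calc x ^ p ≤ (1 + x) ^ q := h1
    _ ≤ (q / η * Real.exp (η * (1 + x) / q)) ^ q := by gcongr
    _ = (q / η) ^ q * Real.exp (η * (1 + x)) := by
        rw [Real.mul_rpow (by positivity) (by positivity), ← Real.exp_mul]
        congr 2; field_simp
    _ = _ := by rw [mul_assoc, ← Real.exp_add]; congr 2; ring

/-- Powers with exponent in `(0,1)` are bounded by affine functions of arbitrarily small slope. -/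
lemma exists_rpow_le_affine {β : ℝ} (hβ0 : 0 < β) (hβ1 : β < 1) {η : ℝ} (hη : 0 < η) :
    ∃ C : ℝ, 0 < C ∧ ∀ x : ℝ, 0 ≤ x → x ^ β ≤ C + η * x := by
  set X : ℝ := η ^ (-(1 - β)⁻¹) with hX
  have hX0 : 0 < X := by positivity
  refine ⟨X ^ β, by positivity, fun x hx => ?_⟩
  rcases le_total x X with h | h
  · have := Real.rpow_le_rpow hx h hβ0.le
    nlinarith
  · have hx0 : 0 < x := hX0.trans_le h
    have h1 : x ^ (β - 1) ≤ X ^ (β - 1) := Real.rpow_le_rpow_of_nonpos hX0 h (by linarith)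
    have h2 : X ^ (β - 1) = η := by
      rw [hX, ← Real.rpow_mul hη.le]
      have : -(1 - β)⁻¹ * (β - 1) = 1 := by
        have : 1 - β ≠ 0 := by linarith
        field_simp; ring
      rw [this, Real.rpow_one]
    have h3 : x ^ β = x ^ (β - 1) * x := by
      rw [← Real.rpow_add_one hx0.ne']; congr 1; ring
    have : 0 < X ^ β := by positivity
    rw [h3]
    nlinarith

/-- The ray issuing from the real point `σ` in the direction `exp (iφ)`. -/
noncomputable def hankelRay (φ σ r : ℝ) : ℂ := σ + r * Complex.exp (φ * Complex.I)

/-- The Hankel integrand `s ^ p * exp s`. -/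
noncomputable def hankelKernel (p : ℝ) (s : ℂ) : ℂ := s ^ (p : ℂ) * Complex.exp s

/-- Half of the Hankel integral, along the ray from `σ` in the direction `exp (iφ)`. -/
noncomputable def hankelHalf (φ p σ : ℝ) : ℂ :=
  ∫ r in Ioi (0 : ℝ), hankelKernel p (hankelRay φ σ r) * Complex.exp (φ * Complex.I)

lemma hankelRay_re (φ σ r : ℝ) : (hankelRay φ σ r).re = σ + r * Real.cos φ := by
  simp [hankelRay, Complex.exp_ofReal_mul_I_re]

lemma hankelRay_im (φ σ r : ℝ) : (hankelRay φ σ r).im = r * Real.sin φ := by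
  simp [hankelRay, Complex.exp_ofReal_mul_I_im]

lemma norm_hankelRay_le {φ σ r : ℝ} (hσ : 0 ≤ σ) (hr : 0 ≤ r) : ‖hankelRay φ σ r‖ ≤ σ + r := by
  refine (norm_add_le _ _).trans ?_
  simp [Complex.norm_exp_ofReal_mul_I, abs_of_nonneg hσ, abs_of_nonneg hr]

lemma sin_mul_le_norm_hankelRay (φ σ r : ℝ) : σ * Real.sin φ ≤ ‖hankelRay φ σ r‖ := by
  have h : ‖hankelRay φ σ r‖ = ‖σ * Complex.exp ((-φ : ℝ) * Complex.I) + r‖ := by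
    have : hankelRay φ σ r =
        Complex.exp (φ * Complex.I) * (σ * Complex.exp ((-φ : ℝ) * Complex.I) + r) := by
      have h2 : Complex.exp (φ * Complex.I) * Complex.exp ((-φ : ℝ) * Complex.I) = 1 := by
        rw [← Complex.exp_add]; simp
      rw [hankelRay]; linear_combination -(σ : ℂ) * h2
    rw [this, norm_mul, Complex.norm_exp_ofReal_mul_I, one_mul]
  rw [h]
  refine le_trans ?_ (Complex.abs_im_le_norm _)
  simp only [Complex.add_im, Complex.im_ofReal_mul,
    Complex.exp_ofReal_mul_I_im, Complex.ofReal_im, Real.sin_neg, add_zero]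
  rw [mul_neg, abs_neg]
  exact le_abs_self _

lemma hankelRay_mem_slitPlane {φ σ r : ℝ} (hφ : 0 < Real.sin φ) (hr : 0 ≤ r)
    (h : 0 < σ ∨ 0 < r) : hankelRay φ σ r ∈ Complex.slitPlane := by
  rw [Complex.mem_slitPlane_iff, hankelRay_re, hankelRay_im]
  rcases hr.lt_or_eq with hr' | hr'
  · right; positivity
  · left; rcases h with h | h
    · simpa [← hr'] using h
    · linarith

lemma hankelRay_ne_zero {φ σ r : ℝ} (hφ : 0 < Real.sin φ) (hr : 0 ≤ r)
    (h : 0 < σ ∨ 0 < r) : hankelRay φ σ r ≠ 0 :=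
  Complex.slitPlane_ne_zero (hankelRay_mem_slitPlane hφ hr h)

lemma norm_hankelKernel (p : ℝ) (s : ℂ) :
    ‖hankelKernel p s‖ = ‖s‖ ^ p * Real.exp s.re := by
  rw [hankelKernel, norm_mul, Complex.norm_cpow_real, Complex.norm_exp]

lemma hasDerivAt_hankelKernel (p : ℝ) {s : ℂ} (hs : s ∈ Complex.slitPlane) :
    HasDerivAt (hankelKernel p) (p * hankelKernel (p - 1) s + hankelKernel p s) s := by
  have := ((hasDerivAt_id s).cpow_const (c := (p : ℂ)) hs).mul (Complex.hasDerivAt_exp s)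
  refine this.congr_deriv ?_
  simp only [hankelKernel, id]
  push_cast
  ring

lemma hasDerivAt_hankelRay (φ σ r : ℝ) :
    HasDerivAt (fun r => hankelRay φ σ r) (Complex.exp (φ * Complex.I)) r := by
  have := ((hasDerivAt_id r).ofReal_comp.mul_const (Complex.exp (φ * Complex.I))).const_add (σ : ℂ)
  simpa [hankelRay] using this

lemma hasDerivAt_hankelRay_start (φ σ r : ℝ) :
    HasDerivAt (fun σ => hankelRay φ σ r) 1 σ := by
  have := ((hasDerivAt_id σ).ofReal_comp).add_const ((r : ℂ) * Complex.exp (φ * Complex.I))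
  simpa [hankelRay] using this

@[fun_prop]
lemma measurable_hankelKernel (p : ℝ) : Measurable (hankelKernel p) := by
  unfold hankelKernel; fun_prop

@[fun_prop]
lemma continuous_hankelRay (φ σ : ℝ) : Continuous (hankelRay φ σ) := by
  unfold hankelRay; fun_prop

/-- Exponential bound for the Hankel integrand on rays, uniform in the exponent and in the
starting point as long as the latter stays away from the origin. -/
lemma exists_norm_hankelKernel_le {φ : ℝ} (hs : 0 < Real.sin φ) (hc : Real.cos φ < 0)
    (N : ℝ) {σ₁ : ℝ} (hσ₁ : 0 < σ₁) (σ₂ : ℝ) :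
    ∃ C : ℝ, 0 < C ∧ ∀ p : ℝ, |p| ≤ N → ∀ σ ∈ Icc σ₁ σ₂, ∀ r : ℝ, 0 ≤ r →
      ‖hankelKernel p (hankelRay φ σ r)‖ ≤ C * Real.exp (Real.cos φ / 2 * r) := by
  obtain ⟨C, hC, hCb⟩ := exists_rpow_le_exp N (η := -Real.cos φ / 2) (by linarith)
  set m : ℝ := min (σ₁ * Real.sin φ) 1 with hm
  have hm0 : 0 < m := by positivity
  have hm1 : m ≤ 1 := min_le_right _ _
  refine ⟨(C * Real.exp (-Real.cos φ / 2 * σ₂) + m ^ (-N)) * Real.exp σ₂, by positivity,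
    fun p hp σ hσ r hr => ?_⟩
  have hσ0 : 0 ≤ σ := hσ₁.le.trans hσ.1
  rw [norm_hankelKernel, hankelRay_re]
  have hle := norm_hankelRay_le (φ := φ) hσ0 hr
  have hge : m ≤ ‖hankelRay φ σ r‖ := by
    refine (min_le_left _ _).trans ((?_ : _ ≤ σ * Real.sin φ).trans
      (sin_mul_le_norm_hankelRay φ σ r))
    exact mul_le_mul_of_nonneg_right hσ.1 hs.le
  have key : ‖hankelRay φ σ r‖ ^ p ≤
      (C * Real.exp (-Real.cos φ / 2 * σ₂) + m ^ (-N)) * Real.exp (-Real.cos φ / 2 * r) := by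
    have hmN : 0 < m ^ (-N) := by positivity
    have he1 : 1 ≤ Real.exp (-Real.cos φ / 2 * r) :=
      Real.one_le_exp (mul_nonneg (by linarith) hr)
    rcases le_total 0 p with h0 | h0
    · calc ‖hankelRay φ σ r‖ ^ p ≤ C * Real.exp (-Real.cos φ / 2 * ‖hankelRay φ σ r‖) :=
            hCb p h0 ((le_abs_self p).trans hp) _ (norm_nonneg _)
        _ ≤ C * Real.exp (-Real.cos φ / 2 * (σ₂ + r)) := by
            gcongr
            · linarith
            · linarith [hσ.2]
        _ = C * Real.exp (-Real.cos φ / 2 * σ₂) * Real.exp (-Real.cos φ / 2 * r) := by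
            rw [mul_assoc, ← Real.exp_add]; congr 2; ring
        _ ≤ _ := by gcongr; linarith
    · calc ‖hankelRay φ σ r‖ ^ p ≤ m ^ p := Real.rpow_le_rpow_of_nonpos hm0 hge h0
        _ ≤ m ^ (-N) := Real.rpow_le_rpow_of_exponent_ge hm0 hm1
            (by linarith [neg_abs_le p])
        _ ≤ (C * Real.exp (-Real.cos φ / 2 * σ₂) + m ^ (-N)) * 1 := by
            have : 0 < C * Real.exp (-Real.cos φ / 2 * σ₂) := by positivity
            linarith
        _ ≤ _ := by gcongr
  calc ‖hankelRay φ σ r‖ ^ p * Real.exp (σ + r * Real.cos φ)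
      ≤ ((C * Real.exp (-Real.cos φ / 2 * σ₂) + m ^ (-N)) * Real.exp (-Real.cos φ / 2 * r)) *
        (Real.exp σ₂ * Real.exp (r * Real.cos φ)) := by
        rw [Real.exp_add]
        gcongr
        exact hσ.2
    _ = (C * Real.exp (-Real.cos φ / 2 * σ₂) + m ^ (-N)) * Real.exp σ₂ *
        (Real.exp (-Real.cos φ / 2 * r) * Real.exp (r * Real.cos φ)) := by ring
    _ = _ := by rw [← Real.exp_add]; congr 2; ring

/-- Exponential bound for the Hankel integrand on rays, for nonnegative exponents. -/
lemma exists_norm_hankelKernel_le_of_nonneg {φ : ℝ} (hc : Real.cos φ < 0)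
    {p : ℝ} (hp : 0 ≤ p) (σ₂ : ℝ) :
    ∃ C : ℝ, 0 < C ∧ ∀ σ ∈ Icc 0 σ₂, ∀ r : ℝ, 0 ≤ r →
      ‖hankelKernel p (hankelRay φ σ r)‖ ≤ C * Real.exp (Real.cos φ / 2 * r) := by
  obtain ⟨C, hC, hCb⟩ := exists_rpow_le_exp p (η := -Real.cos φ / 2) (by linarith)
  refine ⟨C * Real.exp (-Real.cos φ / 2 * σ₂) * Real.exp σ₂, by positivity,
    fun σ hσ r hr => ?_⟩
  rw [norm_hankelKernel, hankelRay_re]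
  have hle := norm_hankelRay_le (φ := φ) hσ.1 hr
  calc ‖hankelRay φ σ r‖ ^ p * Real.exp (σ + r * Real.cos φ)
      ≤ (C * Real.exp (-Real.cos φ / 2 * (σ₂ + r))) *
        (Real.exp σ₂ * Real.exp (r * Real.cos φ)) := by
        rw [Real.exp_add]
        gcongr
        · refine (hCb p hp le_rfl _ (norm_nonneg _)).trans ?_
          gcongr
          · linarith
          · linarith [hσ.2]
        · exact hσ.2
    _ = C * Real.exp σ₂ * (Real.exp (-Real.cos φ / 2 * (σ₂ + r)) *
        Real.exp (r * Real.cos φ)) := by ring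
    _ = C * Real.exp σ₂ * (Real.exp (-Real.cos φ / 2 * σ₂) * Real.exp (Real.cos φ / 2 * r)) := by
        rw [← Real.exp_add, ← Real.exp_add]; congr 2; ring
    _ = _ := by ring

lemma integrableOn_hankelBound {φ : ℝ} (hc : Real.cos φ < 0) (C : ℝ) :
    IntegrableOn (fun r => C * Real.exp (Real.cos φ / 2 * r)) (Ioi 0) :=
  (integrableOn_exp_mul_Ioi (by linarith) 0).const_mul C

lemma integrableOn_hankelKernel {φ : ℝ} (hs : 0 < Real.sin φ) (hc : Real.cos φ < 0)
    (p : ℝ) {σ : ℝ} (hσ : 0 < σ) :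
    IntegrableOn (fun r => hankelKernel p (hankelRay φ σ r)) (Ioi 0) := by
  obtain ⟨C, -, hC⟩ := exists_norm_hankelKernel_le hs hc |p| hσ σ
  refine (integrableOn_hankelBound hc C).mono' ?_ ?_
  · exact ((measurable_hankelKernel p).comp
      (continuous_hankelRay φ σ).measurable).aestronglyMeasurable
  · exact (ae_restrict_mem measurableSet_Ioi).mono fun r hr =>
      hC p le_rfl σ ⟨le_rfl, le_rfl⟩ r (le_of_lt hr)

lemma tendsto_hankelKernel_hankelRay {φ : ℝ} (hs : 0 < Real.sin φ) (hc : Real.cos φ < 0)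
    (p : ℝ) {σ : ℝ} (hσ : 0 < σ) :
    Tendsto (fun r => hankelKernel p (hankelRay φ σ r)) atTop (nhds 0) := by
  obtain ⟨C, -, hC⟩ := exists_norm_hankelKernel_le hs hc |p| hσ σ
  refine squeeze_zero_norm' ((eventually_ge_atTop 0).mono fun r hr =>
    hC p le_rfl σ ⟨le_rfl, le_rfl⟩ r hr) ?_
  have h : Tendsto (fun r : ℝ => Real.exp (Real.cos φ / 2 * r)) atTop (nhds 0) :=
    Real.tendsto_exp_atBot.comp (tendsto_id.const_mul_atTop_of_neg (by linarith))
  simpa using h.const_mul C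

/-- Integration by parts along the ray. -/
lemma hankelHalf_add {φ : ℝ} (hs : 0 < Real.sin φ) (hc : Real.cos φ < 0)
    (p : ℝ) {σ : ℝ} (hσ : 0 < σ) :
    p * hankelHalf φ (p - 1) σ + hankelHalf φ p σ = -hankelKernel p σ := by
  have hi := fun q => (integrableOn_hankelKernel hs hc q hσ).mul_const
    (Complex.exp (φ * Complex.I))
  have hd : ∀ r ∈ Ici (0 : ℝ), HasDerivAt (fun r => hankelKernel p (hankelRay φ σ r))
      (p * (hankelKernel (p - 1) (hankelRay φ σ r) * Complex.exp (φ * Complex.I)) +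
        hankelKernel p (hankelRay φ σ r) * Complex.exp (φ * Complex.I)) r := fun r hr =>
    ((hasDerivAt_hankelKernel p (hankelRay_mem_slitPlane hs hr (Or.inl hσ))).comp r
      (hasDerivAt_hankelRay φ σ r)).congr_deriv (by ring)
  have h := integral_Ioi_of_hasDerivAt_of_tendsto' hd (((hi (p - 1)).const_mul _).add (hi p))
    (tendsto_hankelKernel_hankelRay hs hc p hσ)
  rw [integral_add ((hi (p - 1)).const_mul _) (hi p), integral_const_mul] at h
  simpa [hankelHalf, hankelRay] using h

lemma hasDerivAt_hankelHalf {φ : ℝ} (hs : 0 < Real.sin φ) (hc : Real.cos φ < 0)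
    (p : ℝ) {σ : ℝ} (hσ : 0 < σ) :
    HasDerivAt (hankelHalf φ p) (-hankelKernel p σ) σ := by
  obtain ⟨C, hC0, hC⟩ := exists_norm_hankelKernel_le hs hc (|p| + 1) (half_pos hσ) (σ + 1)
  have hi := fun q => (integrableOn_hankelKernel hs hc q hσ).mul_const
    (Complex.exp (φ * Complex.I))
  have hmeas : ∀ q σ', AEStronglyMeasurable (fun r => hankelKernel q (hankelRay φ σ' r) *
      Complex.exp (φ * Complex.I)) (volume.restrict (Ioi 0)) := fun q σ' =>
    (((measurable_hankelKernel q).comp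
      (continuous_hankelRay φ σ').measurable).mul_const _).aestronglyMeasurable
  have h := (hasDerivAt_integral_of_dominated_loc_of_deriv_le (μ := volume.restrict (Ioi 0))
    (F := fun σ r => hankelKernel p (hankelRay φ σ r) * Complex.exp (φ * Complex.I))
    (F' := fun σ r => p * (hankelKernel (p - 1) (hankelRay φ σ r) * Complex.exp (φ * Complex.I)) +
        hankelKernel p (hankelRay φ σ r) * Complex.exp (φ * Complex.I))
    (bound := fun r => ((|p| + 1) * C) * Real.exp (Real.cos φ / 2 * r))
    (Icc_mem_nhds (half_lt_self hσ) (lt_add_one σ))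
    (Eventually.of_forall fun σ' => hmeas p σ') (hi p)
    (((hmeas (p - 1) σ).const_mul _).add (hmeas p σ)) ?_
    (integrableOn_hankelBound hc _) ?_).2
  · rw [integral_add ((hi (p - 1)).const_mul _) (hi p), integral_const_mul] at h
    exact h.congr_deriv (hankelHalf_add hs hc p hσ)
  · filter_upwards [ae_restrict_mem measurableSet_Ioi] with r hr σ' hσ'
    have h1 := hC (p - 1) ((abs_sub _ _).trans (by simp)) σ' hσ' r (le_of_lt hr)
    have h2 := hC p (by linarith) σ' hσ' r (le_of_lt hr)
    refine (norm_add_le _ _).trans ?_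
    simp only [norm_mul, Complex.norm_exp_ofReal_mul_I, mul_one, Complex.norm_real,
      Real.norm_eq_abs]
    have := mul_le_mul_of_nonneg_left h1 (abs_nonneg p)
    linarith
  · filter_upwards [ae_restrict_mem measurableSet_Ioi] with r hr σ' hσ'
    have hm := hankelRay_mem_slitPlane hs (le_of_lt hr) (Or.inr hr) (σ := σ')
    exact (((hasDerivAt_hankelKernel p hm).comp_of_eq σ'
      (hasDerivAt_hankelRay_start φ σ' r) rfl).mul_const _).congr_deriv (by ring)

lemma hankelKernel_ofReal_im (p : ℝ) {σ : ℝ} (hσ : 0 ≤ σ) : (hankelKernel p σ).im = 0 := by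
  rw [hankelKernel, ← Complex.ofReal_cpow hσ, ← Complex.ofReal_exp, ← Complex.ofReal_mul,
    Complex.ofReal_im]

lemma continuousOn_hankelHalf {φ : ℝ} (hs : 0 < Real.sin φ) (hc : Real.cos φ < 0)
    {p : ℝ} (hp : 0 ≤ p) (σ₂ : ℝ) : ContinuousOn (hankelHalf φ p) (Icc 0 σ₂) := by
  obtain ⟨C, -, hC⟩ := exists_norm_hankelKernel_le_of_nonneg hc hp σ₂
  refine continuousOn_of_dominated (bound := fun r => C * Real.exp (Real.cos φ / 2 * r))
    (fun σ' _ => ?_) (fun σ' hσ' => ?_) (integrableOn_hankelBound hc C) ?_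
  · exact (((measurable_hankelKernel p).comp
      (continuous_hankelRay φ σ').measurable).mul_const _).aestronglyMeasurable
  · filter_upwards [ae_restrict_mem measurableSet_Ioi] with r hr
    rw [norm_mul, Complex.norm_exp_ofReal_mul_I, mul_one]
    exact hC σ' hσ' r (le_of_lt hr)
  · filter_upwards [ae_restrict_mem measurableSet_Ioi] with r hr σ' hσ'
    have hm := hankelRay_mem_slitPlane hs (le_of_lt hr) (Or.inr hr) (σ := σ')
    exact (((hasDerivAt_hankelKernel p hm).comp_of_eq σ'
      (hasDerivAt_hankelRay_start φ σ' r) rfl).mul_const _).continuousAt.continuousWithinAt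

/-- The imaginary part of the half Hankel integral does not depend on the starting point. -/
lemma hankelHalf_im_eq_zero_start {φ : ℝ} (hs : 0 < Real.sin φ) (hc : Real.cos φ < 0)
    {p : ℝ} (hp : 0 ≤ p) {σ : ℝ} (hσ : 0 < σ) :
    (hankelHalf φ p σ).im = (hankelHalf φ p 0).im := by
  obtain ⟨ξ, hξ, h⟩ := exists_hasDerivAt_eq_slope (fun σ => (hankelHalf φ p σ).im)
    (fun _ => 0) hσ
    (Complex.continuous_im.comp_continuousOn (continuousOn_hankelHalf hs hc hp σ))
    (fun x hx => by
      have := Complex.imCLM.hasFDerivAt.comp_hasDerivAt x (hasDerivAt_hankelHalf hs hc p hx.1)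
      simpa [hankelKernel_ofReal_im p hx.1.le] using! this)
  rw [eq_div_iff (by simpa using hσ.ne')] at h
  linarith

/-- The Gamma integrand along the ray in the direction `exp (iθ)`. -/
noncomputable def gammaRay (p θ r : ℝ) : ℂ :=
  (r ^ p : ℝ) * Complex.exp ((p + 1) * θ * Complex.I) *
    Complex.exp (r * Complex.exp (θ * Complex.I))

lemma norm_gammaRay (p θ : ℝ) {r : ℝ} (hr : 0 ≤ r) :
    ‖gammaRay p θ r‖ = r ^ p * Real.exp (Real.cos θ * r) := by
  have h1 : ‖Complex.exp ((p + 1) * θ * Complex.I)‖ = 1 := by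
    have := Complex.norm_exp_ofReal_mul_I ((p + 1) * θ)
    push_cast at this; exact this
  rw [gammaRay, norm_mul, norm_mul, h1, Complex.norm_exp, Complex.re_ofReal_mul,
    Complex.exp_ofReal_mul_I_re, Complex.norm_real, Real.norm_of_nonneg (by positivity),
    mul_one, mul_comm r]

lemma measurable_gammaRay (p θ : ℝ) : Measurable (gammaRay p θ) := by
  unfold gammaRay; fun_prop

lemma integrableOn_rpow_mul_exp {p b : ℝ} (hp : 0 ≤ p) (hb : b < 0) :
    IntegrableOn (fun r : ℝ => r ^ p * Real.exp (b * r)) (Ioi 0) := by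
  have := integrableOn_rpow_mul_exp_neg_mul_rpow (p := 1) (s := p) (b := -b)
    (by linarith) one_pos (by linarith)
  simpa using this

lemma integrableOn_gammaRay {p θ : ℝ} (hp : 0 ≤ p) (hθ : Real.cos θ < 0) :
    IntegrableOn (gammaRay p θ) (Ioi 0) := by
  refine (integrableOn_rpow_mul_exp hp hθ).mono' (measurable_gammaRay p θ).aestronglyMeasurable ?_
  filter_upwards [ae_restrict_mem measurableSet_Ioi] with r hr
  exact (norm_gammaRay p θ (le_of_lt hr)).le

lemma gammaRay_add_one (p θ : ℝ) {r : ℝ} (hr : 0 ≤ r) (hp : 0 ≤ p) :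
    gammaRay (p + 1) θ r = r * Complex.exp (θ * Complex.I) * gammaRay p θ r := by
  have h : Complex.exp (((p + 1 : ℝ) + 1) * θ * Complex.I) =
      Complex.exp (θ * Complex.I) * Complex.exp ((p + 1) * θ * Complex.I) := by
    rw [← Complex.exp_add]; congr 1; push_cast; ring
  rw [gammaRay, gammaRay, h, Real.rpow_add_one' hr (by linarith)]
  push_cast; ring

lemma integral_gammaRay_eq {p θ : ℝ} (hp : 0 ≤ p) (hθ : Real.cos θ < 0) :
    ∫ r in Ioi (0 : ℝ), ((p + 1) * Complex.I * gammaRay p θ r +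
      Complex.I * gammaRay (p + 1) θ r) = 0 := by
  have hd : ∀ r ∈ Ici (0 : ℝ), HasDerivAt (fun r : ℝ => Complex.I *
      ((r ^ (p + 1) : ℝ) * Complex.exp ((p + 1) * θ * Complex.I) *
        Complex.exp (r * Complex.exp (θ * Complex.I))))
      ((p + 1) * Complex.I * gammaRay p θ r + Complex.I * gammaRay (p + 1) θ r) r := by
    intro r hr
    have h1 := (Real.hasDerivAt_rpow_const (x := r) (p := p + 1)
      (Or.inr (by linarith))).ofReal_comp.mul_const (Complex.exp ((p + 1) * θ * Complex.I))
    have h2 := ((hasDerivAt_id r).ofReal_comp.mul_const (Complex.exp (θ * Complex.I))).cexp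
    refine ((h1.mul h2).const_mul Complex.I).congr_deriv ?_
    rw [gammaRay_add_one p θ hr hp, gammaRay, Real.rpow_add_one' hr (by linarith)]
    simp only [add_sub_cancel_right, id]
    push_cast
    ring
  have hi := ((integrableOn_gammaRay hp hθ).const_mul ((p + 1) * Complex.I)).add
    ((integrableOn_gammaRay (by linarith : 0 ≤ p + 1) hθ).const_mul Complex.I)
  have ht : Tendsto (fun r : ℝ => Complex.I *
      ((r ^ (p + 1) : ℝ) * Complex.exp ((p + 1) * θ * Complex.I) *
        Complex.exp (r * Complex.exp (θ * Complex.I)))) atTop (nhds 0) := by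
    refine squeeze_zero_norm' ?_
      (tendsto_rpow_mul_exp_neg_mul_atTop_nhds_zero (p + 1) (-Real.cos θ) (by linarith))
    filter_upwards [eventually_ge_atTop 0] with r hr
    have h1 : ‖Complex.exp ((p + 1) * θ * Complex.I)‖ = 1 := by
      have := Complex.norm_exp_ofReal_mul_I ((p + 1) * θ)
      push_cast at this; exact this
    rw [norm_mul, Complex.norm_I, one_mul, norm_mul, norm_mul, h1, Complex.norm_exp,
      Complex.re_ofReal_mul, Complex.exp_ofReal_mul_I_re, Complex.norm_real,
      Real.norm_of_nonneg (by positivity), mul_one, mul_comm r, neg_neg]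
  have h := integral_Ioi_of_hasDerivAt_of_tendsto' hd hi ht
  rw [h, Real.zero_rpow (by linarith)]
  simp

lemma hasDerivAt_integral_gammaRay {p θ : ℝ} (hp : 0 ≤ p) (hθ : Real.cos θ < 0) :
    HasDerivAt (fun θ => ∫ r in Ioi (0 : ℝ), gammaRay p θ r) 0 θ := by
  have hmem : {x | Real.cos x < Real.cos θ / 2} ∈ nhds θ :=
    (isOpen_lt Real.continuous_cos continuous_const).mem_nhds
      (show Real.cos θ < Real.cos θ / 2 by linarith)
  have h := (hasDerivAt_integral_of_dominated_loc_of_deriv_le (μ := volume.restrict (Ioi 0))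
    (F := fun θ r => gammaRay p θ r)
    (F' := fun θ r => (p + 1) * Complex.I * gammaRay p θ r + Complex.I * gammaRay (p + 1) θ r)
    (bound := fun r => (p + 1) * (r ^ p * Real.exp (Real.cos θ / 2 * r)) +
      r ^ (p + 1) * Real.exp (Real.cos θ / 2 * r))
    hmem
    (Eventually.of_forall fun θ' => (measurable_gammaRay p θ').aestronglyMeasurable)
    (integrableOn_gammaRay hp hθ)
    (((measurable_gammaRay p θ).const_mul _).add
      ((measurable_gammaRay _ θ).const_mul _)).aestronglyMeasurable ?_
    (((integrableOn_rpow_mul_exp hp (by linarith)).const_mul _).add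
      (integrableOn_rpow_mul_exp (by linarith) (by linarith))) ?_).2
  · exact h.congr_deriv (integral_gammaRay_eq hp hθ)
  · filter_upwards [ae_restrict_mem measurableSet_Ioi] with r hr θ' hθ'
    have hr0 : 0 ≤ r := le_of_lt hr
    have hθ'' : Real.cos θ' ≤ Real.cos θ / 2 := le_of_lt hθ'
    have hn : ‖(p : ℂ) + 1‖ = p + 1 := by
      rw [← Complex.ofReal_one, ← Complex.ofReal_add, Complex.norm_real,
        Real.norm_of_nonneg (by linarith)]
    refine (norm_add_le _ _).trans ?_
    rw [norm_mul, norm_mul, norm_mul, Complex.norm_I, norm_gammaRay p _ hr0,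
      norm_gammaRay _ _ hr0, hn, mul_one, one_mul]
    gcongr
  · filter_upwards [ae_restrict_mem measurableSet_Ioi] with r hr θ' hθ'
    have h1 : HasDerivAt (fun x : ℝ => ((p : ℂ) + 1) * x * Complex.I)
        (((p : ℂ) + 1) * Complex.I) θ' := by
      simpa using (((hasDerivAt_id θ').ofReal_comp).const_mul ((p : ℂ) + 1)).mul_const Complex.I
    have h2 : HasDerivAt (fun x : ℝ => (x : ℂ) * Complex.I) Complex.I θ' := by
      simpa using ((hasDerivAt_id θ').ofReal_comp).mul_const Complex.I
    have h3 := (h1.cexp.const_mul ((r ^ p : ℝ) : ℂ)).mul (h2.cexp.const_mul (r : ℂ)).cexp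
    refine h3.congr_deriv ?_
    rw [gammaRay_add_one p θ' (le_of_lt hr) hp, gammaRay]
    ring

lemma integral_gammaRay {p φ : ℝ} (hp : 0 ≤ p) (h1 : π / 2 < φ) (h2 : φ < π) :
    ∫ r in Ioi (0 : ℝ), gammaRay p φ r =
      Complex.exp ((p + 1) * π * Complex.I) * Real.Gamma (p + 1) := by
  have hcos : ∀ x ∈ Icc φ π, Real.cos x < 0 := fun x hx =>
    Real.cos_neg_of_pi_div_two_lt_of_lt (h1.trans_le hx.1) (by linarith [hx.2, Real.pi_pos])
  have hconst := constant_of_has_deriv_right_zero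
    (f := fun θ => ∫ r in Ioi (0 : ℝ), gammaRay p θ r) (a := φ) (b := π)
    (fun x hx => (hasDerivAt_integral_gammaRay hp (hcos x hx)).continuousAt.continuousWithinAt)
    (fun x hx => (hasDerivAt_integral_gammaRay hp (hcos x ⟨hx.1, hx.2.le⟩)).hasDerivWithinAt)
    π ⟨h2.le, le_rfl⟩
  rw [← hconst, Real.Gamma_eq_integral (by linarith), ← integral_complex_ofReal, ← integral_const_mul]
  refine setIntegral_congr_fun measurableSet_Ioi fun r hr => ?_
  simp only [gammaRay, Complex.exp_pi_mul_I, add_sub_cancel_right]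
  push_cast
  simp only [mul_neg, mul_one]
  ring

lemma Gamma_inv_neg (p : ℝ) (hp : 0 ≤ p) :
    Real.sin (π * (p + 1)) * Real.Gamma (p + 1) = π * (Real.Gamma (-p))⁻¹ := by
  have h := congrArg (fun x => x⁻¹) (Real.Gamma_mul_Gamma_one_sub (p + 1))
  simp only [mul_inv, inv_div] at h
  have h0 : Real.Gamma (p + 1) ≠ 0 := (Real.Gamma_pos_of_pos (by linarith)).ne'
  have h1 : 1 - (p + 1) = -p := by ring
  rw [h1, eq_div_iff Real.pi_ne_zero] at h
  rw [← h]
  field_simp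

lemma hankelHalf_zero_im {p φ : ℝ} (hp : 0 ≤ p) (h1 : π / 2 < φ) (h2 : φ < π) :
    (hankelHalf φ p 0).im = π * (Real.Gamma (-p))⁻¹ := by
  have : hankelHalf φ p 0 = ∫ r in Ioi (0 : ℝ), gammaRay p φ r := by
    refine setIntegral_congr_fun measurableSet_Ioi fun r hr => ?_
    have hr0 : (0 : ℝ) < r := hr
    have hlog : Complex.log (r * Complex.exp (φ * Complex.I)) = Real.log r + φ * Complex.I := by
      rw [Complex.log_ofReal_mul hr0 (Complex.exp_ne_zero _), Complex.log_exp] <;>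
        simp <;> linarith [Real.pi_pos]
    have hpow : ((r : ℂ) * Complex.exp (φ * Complex.I)) ^ (p : ℂ) *
        Complex.exp (φ * Complex.I) = (r ^ p : ℝ) * Complex.exp ((p + 1) * φ * Complex.I) := by
      rw [Complex.cpow_def_of_ne_zero (mul_ne_zero (by exact_mod_cast hr0.ne')
        (Complex.exp_ne_zero _)), hlog, Real.rpow_def_of_pos hr0, Complex.ofReal_exp,
        ← Complex.exp_add, ← Complex.exp_add]
      congr 1
      push_cast
      ring
    simp only [hankelKernel, hankelRay, gammaRay, Complex.ofReal_zero, zero_add]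
    rw [← hpow]
    ring
  rw [this, integral_gammaRay hp h1 h2, ← Gamma_inv_neg p hp, Complex.im_mul_ofReal]
  congr 1
  have := Complex.exp_ofReal_mul_I_im ((p + 1) * π)
  push_cast at this
  rw [this, mul_comm]

lemma continuous_Gamma_inv_neg : Continuous fun p : ℝ => (Real.Gamma (-p))⁻¹ := by
  have h : Continuous fun p : ℝ => ((Complex.Gamma ((-p : ℝ) : ℂ))⁻¹).re :=
    Complex.continuous_re.comp (Complex.differentiable_one_div_Gamma.continuous.comp
      (Complex.continuous_ofReal.comp continuous_neg))
  refine h.congr fun p => ?_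
  rw [Complex.Gamma_ofReal, ← Complex.ofReal_inv, Complex.ofReal_re]

lemma continuous_hankelHalf_exponent {φ : ℝ} (hs : 0 < Real.sin φ) (hc : Real.cos φ < 0)
    {σ : ℝ} (hσ : 0 < σ) : Continuous fun p => hankelHalf φ p σ := by
  refine continuous_iff_continuousAt.2 fun p₀ => ?_
  obtain ⟨C, -, hC⟩ := exists_norm_hankelKernel_le hs hc (|p₀| + 1) hσ σ
  refine continuousAt_of_dominated (bound := fun r => C * Real.exp (Real.cos φ / 2 * r))
    (Eventually.of_forall fun p => ?_) ?_ (integrableOn_hankelBound hc C) ?_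
  · exact (((measurable_hankelKernel p).comp
      (continuous_hankelRay φ σ).measurable).mul_const _).aestronglyMeasurable
  · filter_upwards [Metric.ball_mem_nhds p₀ one_pos] with p hp
    filter_upwards [ae_restrict_mem measurableSet_Ioi] with r hr
    rw [norm_mul, Complex.norm_exp_ofReal_mul_I, mul_one]
    refine hC p ?_ σ ⟨le_rfl, le_rfl⟩ r (le_of_lt hr)
    rw [Metric.mem_ball, Real.dist_eq] at hp
    linarith [abs_sub_abs_le_abs_sub p p₀]
  · filter_upwards [ae_restrict_mem measurableSet_Ioi] with r hr
    have hne := hankelRay_ne_zero hs (le_of_lt hr) (Or.inl hσ)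
    unfold hankelKernel
    have : ContinuousAt (fun p : ℝ => hankelRay φ σ r ^ (p : ℂ)) p₀ :=
      (continuousAt_const_cpow hne).comp Complex.continuous_ofReal.continuousAt
    exact (this.mul continuousAt_const).mul continuousAt_const

/-- Hankel's formula for the reciprocal Gamma function. -/
lemma hankelHalf_im {φ : ℝ} (h1 : π / 2 < φ) (h2 : φ < π) (p : ℝ) {σ : ℝ} (hσ : 0 < σ) :
    (hankelHalf φ p σ).im = π * (Real.Gamma (-p))⁻¹ := by
  have hs : 0 < Real.sin φ := Real.sin_pos_of_pos_of_lt_pi (by linarith [Real.pi_pos]) h2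
  have hc : Real.cos φ < 0 := Real.cos_neg_of_pi_div_two_lt_of_lt h1 (by linarith [Real.pi_pos])
  have hstep : ∀ q : ℝ, q ≠ 0 → (hankelHalf φ q σ).im = π * (Real.Gamma (-q))⁻¹ →
      (hankelHalf φ (q - 1) σ).im = π * (Real.Gamma (-(q - 1)))⁻¹ := by
    intro q hq h
    have h3 := congrArg Complex.im (hankelHalf_add hs hc q hσ)
    rw [Complex.add_im, Complex.im_ofReal_mul, Complex.neg_im, hankelKernel_ofReal_im q hσ.le,
      neg_zero, h] at h3
    have h4 : -(q - 1) = -q + 1 := by ring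
    rw [h4, Real.Gamma_add_one (neg_ne_zero.2 hq), mul_inv]
    field_simp
    field_simp at h3
    linarith
  have hnonint : ∀ n : ℕ, ∀ q : ℝ, -n ≤ q → (∀ m : ℤ, q ≠ m) →
      (hankelHalf φ q σ).im = π * (Real.Gamma (-q))⁻¹ := by
    intro n
    induction n with
    | zero =>
      intro q hq _
      have hq' : 0 ≤ q := by simpa using hq
      rw [hankelHalf_im_eq_zero_start hs hc hq' hσ, hankelHalf_zero_im hq' h1 h2]
    | succ n ih =>
      intro q hq hm
      push_cast at hq
      have h3 := hstep (q + 1) (fun h => hm (-1) (by push_cast; linarith))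
        (ih (q + 1) (by linarith) fun m h => hm (m - 1) (by push_cast; linarith))
      simpa using h3
  have hdense : Dense (range ((↑) : ℤ → ℝ))ᶜ := (countable_range _).dense_compl ℝ
  have := Continuous.ext_on hdense
    (Complex.continuous_im.comp (continuous_hankelHalf_exponent hs hc hσ))
    (continuous_const.mul continuous_Gamma_inv_neg) (fun q hq => by
      obtain ⟨n, hn⟩ := exists_nat_ge (-q)
      exact hnonint n q (by linarith) fun m h => hq ⟨m, h.symm⟩)
  exact congrFun this p

lemma arg_hankelRay_le {φ σ r : ℝ} (h0 : 0 < φ) (h2 : φ < π) (hσ : 0 < σ) (hr : 0 < r) :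
    0 ≤ (hankelRay φ σ r).arg ∧ (hankelRay φ σ r).arg ≤ φ := by
  have hs : 0 < Real.sin φ := Real.sin_pos_of_pos_of_lt_pi h0 h2
  have him : 0 < (hankelRay φ σ r).im := by rw [hankelRay_im]; positivity
  refine ⟨Complex.arg_nonneg_iff.2 him.le, ?_⟩
  by_contra! hlt
  have hsin : Real.sin (φ - (hankelRay φ σ r).arg) ≤ 0 :=
    Real.sin_nonpos_of_nonpos_of_neg_pi_le (by linarith)
      (by linarith [Complex.arg_le_pi (hankelRay φ σ r)])
  have h3 : Real.sin (φ - (hankelRay φ σ r).arg) * ‖hankelRay φ σ r‖ = σ * Real.sin φ := by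
    have hre := Complex.norm_mul_cos_arg (hankelRay φ σ r)
    have him' := Complex.norm_mul_sin_arg (hankelRay φ σ r)
    rw [hankelRay_re] at hre
    rw [hankelRay_im] at him'
    rw [Real.sin_sub]
    linear_combination Real.sin φ * hre - Real.cos φ * him'
  nlinarith [norm_nonneg (hankelRay φ σ r), mul_pos hσ hs]

lemma cos_mul_le_re_hankelRay_cpow {β φ σ r : ℝ} (hβ : 0 < β) (h0 : 0 < φ) (h2 : φ < π)
    (h3 : β * φ < π / 2) (hσ : 0 < σ) (hr : 0 < r) :
    Real.cos (β * φ) * (σ * Real.sin φ) ^ β ≤ (hankelRay φ σ r ^ (β : ℂ)).re := by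
  have hs : 0 < Real.sin φ := Real.sin_pos_of_pos_of_lt_pi h0 h2
  obtain ⟨ha0, ha1⟩ := arg_hankelRay_le h0 h2 hσ hr
  have hcos : Real.cos (β * φ) ≤ Real.cos ((hankelRay φ σ r).arg * β) :=
    Real.cos_le_cos_of_nonneg_of_le_pi (by positivity) (by linarith [Real.pi_pos])
      (by rw [mul_comm]; gcongr)
  have hcos0 : 0 < Real.cos (β * φ) :=
    Real.cos_pos_of_mem_Ioo ⟨by have : 0 < β * φ := by positivity
                                linarith [Real.pi_pos], h3⟩
  rw [Complex.cpow_ofReal_re, mul_comm]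
  gcongr
  exact sin_mul_le_norm_hankelRay φ σ r

/-- The M-Wright function `M_β(z) = ∑_k (-z)^k / (k! Γ(1 - β(k+1)))`. -/
noncomputable def wrightM (β z : ℝ) : ℝ :=
  ∑' k : ℕ, (-z) ^ k / ((Nat.factorial k : ℝ) * Real.Gamma (1 - β * (k + 1)))

lemma wrightG_eq (β x t : ℝ) : wrightG β x t = t ^ (-β) * wrightM β (x / t ^ β) := by
  simp only [wrightG, wrightM, neg_div]

lemma hankelKernel_mul_cpow_pow (p β : ℝ) {s : ℂ} (hs : s ≠ 0) (k : ℕ) :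
    hankelKernel p s * (s ^ (β : ℂ)) ^ k = hankelKernel (p + β * k) s := by
  have : ((p + β * k : ℝ) : ℂ) = p + β * k := by push_cast; ring
  rw [hankelKernel, hankelKernel, this, Complex.cpow_add _ _ hs, Complex.cpow_mul_nat]
  ring

lemma integrableOn_hankelKernel_mul_exp {β φ σ : ℝ} (hβ0 : 0 < β) (hβ1 : β < 1)
    (hs : 0 < Real.sin φ) (hc : Real.cos φ < 0) (hσ : 0 < σ) (p z : ℝ) (hz : 0 ≤ z) :
    IntegrableOn (fun r => ‖hankelKernel p (hankelRay φ σ r)‖ *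
      Real.exp (z * ‖hankelRay φ σ r‖ ^ β)) (Ioi 0) := by
  obtain ⟨C, hC0, hC⟩ := exists_norm_hankelKernel_le hs hc |p| hσ σ
  have hη : 0 < -Real.cos φ / (4 * (z + 1)) := div_pos (by linarith) (by linarith)
  obtain ⟨D, hD0, hD⟩ := exists_rpow_le_affine hβ0 hβ1 hη
  have hint : IntegrableOn (fun r => C * Real.exp (z * D + -Real.cos φ / 4 * σ) *
      Real.exp (Real.cos φ / 4 * r)) (Ioi 0) :=
    (integrableOn_exp_mul_Ioi (by linarith) 0).const_mul _
  refine hint.mono' ?_ ?_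
  · have := (continuous_hankelRay φ σ).measurable
    have h2 := (measurable_hankelKernel p).comp this
    exact (h2.norm.mul ((this.norm.pow_const β).const_mul z).exp).aestronglyMeasurable
  · filter_upwards [ae_restrict_mem measurableSet_Ioi] with r hr
    have hr0 : (0 : ℝ) ≤ r := le_of_lt hr
    rw [Real.norm_of_nonneg (by positivity)]
    have h1 := hC p le_rfl σ ⟨le_rfl, le_rfl⟩ r hr0
    have h2 : z * ‖hankelRay φ σ r‖ ^ β ≤
        z * D + -Real.cos φ / 4 * σ + -Real.cos φ / 4 * r := by
      have h3 := hD _ (norm_nonneg (hankelRay φ σ r))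
      have h4 := norm_hankelRay_le (φ := φ) hσ.le hr0
      have h5 : z * (-Real.cos φ / (4 * (z + 1))) ≤ -Real.cos φ / 4 := by
        rw [mul_div_assoc', div_le_div_iff₀ (by positivity) (by positivity)]
        nlinarith
      calc z * ‖hankelRay φ σ r‖ ^ β
          ≤ z * (D + -Real.cos φ / (4 * (z + 1)) * (σ + r)) := by
            refine mul_le_mul_of_nonneg_left (h3.trans ?_) hz
            gcongr
        _ = z * D + z * (-Real.cos φ / (4 * (z + 1))) * (σ + r) := by ring
        _ ≤ z * D + -Real.cos φ / 4 * (σ + r) := by gcongr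
        _ = _ := by ring
    calc ‖hankelKernel p (hankelRay φ σ r)‖ * Real.exp (z * ‖hankelRay φ σ r‖ ^ β)
        ≤ C * Real.exp (Real.cos φ / 2 * r) *
          Real.exp (z * D + -Real.cos φ / 4 * σ + -Real.cos φ / 4 * r) := by gcongr
      _ = C * Real.exp (z * D + -Real.cos φ / 4 * σ) *
          (Real.exp (Real.cos φ / 2 * r) * Real.exp (-Real.cos φ / 4 * r)) := by
          rw [Real.exp_add (z * D + -Real.cos φ / 4 * σ)]; ring
      _ = _ := by rw [← Real.exp_add]; congr 2; ring

/-- Hankel integral representation of the M-Wright function. -/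
lemma wrightM_eq_integral {β φ σ : ℝ} (hβ0 : 0 < β) (hβ1 : β < 1) (h1 : π / 2 < φ) (h2 : φ < π)
    (hσ : 0 < σ) (z : ℝ) :
    π * wrightM β z = (∫ r in Ioi (0 : ℝ), hankelKernel (β - 1) (hankelRay φ σ r) *
      Complex.exp (φ * Complex.I) * Complex.exp (-z * hankelRay φ σ r ^ (β : ℂ))).im := by
  have hs : 0 < Real.sin φ := Real.sin_pos_of_pos_of_lt_pi (by linarith [Real.pi_pos]) h2
  have hc : Real.cos φ < 0 := Real.cos_neg_of_pi_div_two_lt_of_lt h1 (by linarith [Real.pi_pos])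
  have hmray := (continuous_hankelRay φ σ).measurable
  have hmker := (measurable_hankelKernel (β - 1)).comp hmray
  have hexp : ∀ r, HasSum (fun k : ℕ => ‖hankelKernel (β - 1) (hankelRay φ σ r)‖ *
      ((|z| * ‖hankelRay φ σ r‖ ^ β) ^ k / (Nat.factorial k : ℝ)))
      (‖hankelKernel (β - 1) (hankelRay φ σ r)‖ * Real.exp (|z| * ‖hankelRay φ σ r‖ ^ β)) := by
    intro r
    rw [Real.exp_eq_exp_ℝ]
    exact (NormedSpace.expSeries_div_hasSum_exp (𝔸 := ℝ) _).mul_left _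
  have hsum := hasSum_integral_of_dominated_convergence (μ := volume.restrict (Ioi (0 : ℝ)))
    (F := fun (k : ℕ) r => hankelKernel (β - 1) (hankelRay φ σ r) *
      Complex.exp (φ * Complex.I) * ((-z * hankelRay φ σ r ^ (β : ℂ)) ^ k / (Nat.factorial k : ℂ)))
    (f := fun r => hankelKernel (β - 1) (hankelRay φ σ r) *
      Complex.exp (φ * Complex.I) * Complex.exp (-z * hankelRay φ σ r ^ (β : ℂ)))
    (fun k r => ‖hankelKernel (β - 1) (hankelRay φ σ r)‖ *
      ((|z| * ‖hankelRay φ σ r‖ ^ β) ^ k / (Nat.factorial k : ℝ)))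
    (fun k => ((hmker.mul_const _).mul
      ((((hmray.pow_const _).const_mul _).pow_const k).div_const _)).aestronglyMeasurable)
    (fun k => Eventually.of_forall fun r => by
      simp [Complex.norm_exp_ofReal_mul_I, Complex.norm_cpow_real])
    (Eventually.of_forall fun r => (hexp r).summable)
    (by
      simp_rw [fun r => (hexp r).tsum_eq]
      exact integrableOn_hankelKernel_mul_exp hβ0 hβ1 hs hc hσ _ _ (abs_nonneg z))
    (Eventually.of_forall fun r => by
      rw [Complex.exp_eq_exp_ℂ]
      exact (NormedSpace.expSeries_div_hasSum_exp (𝔸 := ℂ) _).mul_left _)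
  have hterm : ∀ k : ℕ, (∫ r in Ioi (0 : ℝ), hankelKernel (β - 1) (hankelRay φ σ r) *
      Complex.exp (φ * Complex.I) *
      ((-z * hankelRay φ σ r ^ (β : ℂ)) ^ k / (Nat.factorial k : ℂ))).im =
      π * ((-z) ^ k / ((Nat.factorial k : ℝ) * Real.Gamma (1 - β * (k + 1)))) := by
    intro k
    have h3 : ∫ r in Ioi (0 : ℝ), hankelKernel (β - 1) (hankelRay φ σ r) *
        Complex.exp (φ * Complex.I) *
        ((-z * hankelRay φ σ r ^ (β : ℂ)) ^ k / (Nat.factorial k : ℂ)) =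
        (((-z) ^ k / (Nat.factorial k : ℝ) : ℝ) : ℂ) * hankelHalf φ (β - 1 + β * k) σ := by
      rw [hankelHalf, ← integral_const_mul]
      refine setIntegral_congr_fun measurableSet_Ioi fun r hr => ?_
      rw [← hankelKernel_mul_cpow_pow (β - 1) β
        (hankelRay_ne_zero hs (le_of_lt hr) (Or.inl hσ)) k]
      push_cast
      ring
    rw [h3, Complex.im_ofReal_mul, hankelHalf_im h1 h2 _ hσ,
      show -(β - 1 + β * (k : ℝ)) = 1 - β * (k + 1) by ring]
    ring
  have him := Complex.imCLM.hasSum hsum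
  simp only [Complex.imCLM_apply] at him
  simp_rw [hterm] at him
  rw [wrightM, ← tsum_mul_left, him.tsum_eq]

/-- The M-Wright function is a Laplace-type transform supported as far to the right as desired. -/
lemma exists_wrightM_representation {β : ℝ} (hβ0 : 0 < β) (hβ1 : β < 1) {A : ℝ} (hA : 0 < A) :
    ∃ K W : ℝ → ℂ, IntegrableOn K (Ioi 0) ∧ Measurable W ∧ (∀ r, 0 < r → A ≤ (W r).re) ∧
      (∀ z, π * wrightM β z = (∫ r in Ioi (0 : ℝ), K r * Complex.exp (-z * W r)).im) ∧
      ∀ m : ℕ, (∫ r in Ioi (0 : ℝ), K r * (1 / W r ^ (m + 1))).im =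
        π * (Real.Gamma (1 + β * m))⁻¹ := by
  have hpi := Real.pi_pos
  obtain ⟨φ, h1, h2'⟩ : ∃ φ, π / 2 < φ ∧ φ < min π (π / (2 * β)) := by
    refine exists_between (lt_min (by linarith) ?_)
    rw [div_lt_div_iff₀ (by positivity) (by positivity)]
    nlinarith
  have h2 : φ < π := h2'.trans_le (min_le_left _ _)
  have h0 : 0 < φ := by linarith
  have h3 : β * φ < π / 2 := by
    have := h2'.trans_le (min_le_right _ _)
    rw [lt_div_iff₀ (by positivity)] at this
    linarith
  have hs : 0 < Real.sin φ := Real.sin_pos_of_pos_of_lt_pi h0 h2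
  have hc : Real.cos φ < 0 := Real.cos_neg_of_pi_div_two_lt_of_lt h1 (by linarith)
  have hcos0 : 0 < Real.cos (β * φ) :=
    Real.cos_pos_of_mem_Ioo ⟨by have : 0 < β * φ := by positivity
                                linarith, h3⟩
  set σ : ℝ := (A / Real.cos (β * φ)) ^ β⁻¹ / Real.sin φ with hσdef
  have hσ : 0 < σ := by positivity
  have hAσ : Real.cos (β * φ) * (σ * Real.sin φ) ^ β = A := by
    rw [hσdef, div_mul_cancel₀ _ hs.ne', Real.rpow_inv_rpow (by positivity) hβ0.ne']
    field_simp
  refine ⟨fun r => hankelKernel (β - 1) (hankelRay φ σ r) * Complex.exp (φ * Complex.I),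
    fun r => hankelRay φ σ r ^ (β : ℂ), (integrableOn_hankelKernel hs hc _ hσ).mul_const _,
    (continuous_hankelRay φ σ).measurable.pow_const _, fun r hr => ?_, fun z => ?_, fun m => ?_⟩
  · rw [← hAσ]
    exact cos_mul_le_re_hankelRay_cpow hβ0 h0 h2 h3 hσ hr
  · exact wrightM_eq_integral hβ0 hβ1 h1 h2 hσ z
  · have := hankelHalf_im h1 h2 (-1 - β * m) hσ
    rw [show -(-1 - β * (m : ℝ)) = 1 + β * m by ring] at this
    rw [← this, hankelHalf]
    congr 1
    refine setIntegral_congr_fun measurableSet_Ioi fun r hr => ?_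
    have hne := hankelRay_ne_zero hs (le_of_lt hr) (Or.inl hσ)
    have hpow := hankelKernel_mul_cpow_pow (-1 - β * m) β hne (m + 1)
    rw [show -1 - β * (m : ℝ) + β * ((m + 1 : ℕ) : ℝ) = β - 1 by push_cast; ring] at hpow
    have hne' : (hankelRay φ σ r ^ (β : ℂ)) ^ (m + 1) ≠ 0 :=
      pow_ne_zero _ (by rw [Complex.cpow_ne_zero_iff]; exact Or.inl hne)
    simp only
    rw [← hpow]
    field_simp

lemma exists_abs_wrightM_le {β : ℝ} (hβ0 : 0 < β) (hβ1 : β < 1) {A : ℝ} (hA : 0 < A) :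
    ∃ C, 0 ≤ C ∧ ∀ z, 0 ≤ z → |wrightM β z| ≤ C * Real.exp (-A * z) := by
  obtain ⟨K, W, hK, -, hW, hM, -⟩ := exists_wrightM_representation hβ0 hβ1 hA
  refine ⟨(∫ r in Ioi (0 : ℝ), ‖K r‖) / π, by positivity, fun z hz => ?_⟩
  have h1 : |π * wrightM β z| ≤ ∫ r in Ioi (0 : ℝ), ‖K r‖ * Real.exp (-A * z) := by
    rw [hM z]
    refine (Complex.abs_im_le_norm _).trans (norm_integral_le_of_norm_le (hK.norm.mul_const _) ?_)
    filter_upwards [ae_restrict_mem measurableSet_Ioi] with r hr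
    rw [norm_mul, Complex.norm_exp]
    gcongr
    have := hW r hr
    simp only [Complex.mul_re, Complex.neg_re, Complex.ofReal_re, Complex.neg_im,
      Complex.ofReal_im]
    nlinarith
  rw [abs_mul, abs_of_pos Real.pi_pos, integral_mul_const] at h1
  rw [div_mul_eq_mul_div, le_div_iff₀ Real.pi_pos]
  linarith

lemma measurable_wrightM (β : ℝ) : Measurable (wrightM β) := by
  unfold wrightM
  refine Measurable.tsum fun k => ?_
  fun_prop

lemma integrableOn_pow_mul_exp (m : ℕ) {A : ℝ} (hA : 0 < A) :
    IntegrableOn (fun z : ℝ => z ^ m * Real.exp (-A * z)) (Ioi 0) := by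
  simpa using integrableOn_rpow_mul_exp (p := m) (b := -A) (by positivity) (by linarith)

lemma integrableOn_pow_mul_cexp (m : ℕ) {w : ℂ} (hw : 0 < w.re) :
    IntegrableOn (fun z : ℝ => (z : ℂ) ^ m * Complex.exp (-z * w)) (Ioi 0) := by
  refine (integrableOn_pow_mul_exp m hw).mono' (by fun_prop) ?_
  filter_upwards [ae_restrict_mem measurableSet_Ioi] with z hz
  have hz' : (0 : ℝ) < z := hz
  simp [Complex.norm_exp, abs_of_pos hz', mul_comm]

lemma integral_pow_mul_cexp (m : ℕ) {w : ℂ} (hw : 0 < w.re) :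
    ∫ z in Ioi (0 : ℝ), (z : ℂ) ^ m * Complex.exp (-z * w) = m.factorial * (1 / w ^ (m + 1)) := by
  have hw0 : w ≠ 0 := by rintro rfl; simp at hw
  have hexp : ∀ z : ℝ, HasDerivAt (fun z : ℝ => Complex.exp (-z * w) * (-1 / w))
      (Complex.exp (-z * w)) z := by
    intro z
    have := ((((hasDerivAt_id z).ofReal_comp).neg.mul_const w).cexp).mul_const (-1 / w)
    refine HasDerivAt.congr_deriv this ?_
    simp
    field_simp
  have hlim : ∀ m : ℕ, Tendsto (fun z : ℝ => (z : ℂ) ^ m * (Complex.exp (-z * w) * (-1 / w)))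
      atTop (nhds 0) := by
    intro m
    rw [tendsto_zero_iff_norm_tendsto_zero]
    have h1 := (tendsto_rpow_mul_exp_neg_mul_atTop_nhds_zero m w.re hw).mul_const ‖-1 / w‖
    rw [zero_mul] at h1
    refine h1.congr' ?_
    filter_upwards [eventually_gt_atTop 0] with z hz
    simp [Complex.norm_exp, abs_of_pos hz, mul_comm, mul_left_comm]
  induction m with
  | zero =>
    have h := integral_Ioi_of_hasDerivAt_of_tendsto' (a := 0) (fun z _ => hexp z)
      (by simpa using integrableOn_pow_mul_cexp 0 hw) (by simpa using hlim 0)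
    simp only [pow_zero, one_mul]
    rw [h]
    simp
    ring
  | succ m ih =>
    have hd : ∀ z : ℝ, HasDerivAt (fun z : ℝ => (z : ℂ) ^ (m + 1))
        ((m + 1 : ℂ) * (z : ℂ) ^ m) z := by
      intro z
      have := (hasDerivAt_id z).ofReal_comp.pow (m + 1)
      simpa [Function.comp_def, Pi.pow_def] using this
    have h := integral_Ioi_mul_deriv_eq_deriv_mul (a := 0) (a' := 0) (b' := 0)
      (u := fun z : ℝ => (z : ℂ) ^ (m + 1)) (v := fun z : ℝ => Complex.exp (-z * w) * (-1 / w))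
      (fun z _ => hd z) (fun z _ => hexp z) (integrableOn_pow_mul_cexp (m + 1) hw)
      (IntegrableOn.congr_fun
        ((integrableOn_pow_mul_cexp m hw).const_mul ((m + 1 : ℂ) * (-1 / w)))
        (fun z _ => by simp only [Pi.mul_apply]; ring) measurableSet_Ioi)
      ?_ (hlim (m + 1))
    · rw [h]
      have h2 : ∀ z : ℝ, (m + 1 : ℂ) * (z : ℂ) ^ m * (Complex.exp (-z * w) * (-1 / w)) =
        ((m + 1 : ℂ) * (-1 / w)) * ((z : ℂ) ^ m * Complex.exp (-z * w)) := fun z => by ring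
      simp_rw [h2]
      rw [integral_const_mul, ih, Nat.factorial_succ]
      push_cast
      field_simp
      ring
    · have : Continuous fun z : ℝ => (z : ℂ) ^ (m + 1) * (Complex.exp (-z * w) * (-1 / w)) := by
        fun_prop
      have := (this.tendsto 0).mono_left (nhdsWithin_le_nhds (s := Ioi 0))
      simpa [Pi.mul_def] using this

/-- The moments of the M-Wright function. -/
lemma integral_pow_mul_wrightM {β : ℝ} (hβ0 : 0 < β) (hβ1 : β < 1) (m : ℕ) :
    ∫ z in Ioi (0 : ℝ), z ^ m * wrightM β z = m.factorial / Real.Gamma (1 + β * m) := by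
  obtain ⟨K, W, hK, hWm, hW, hM, hmom⟩ := exists_wrightM_representation hβ0 hβ1 one_pos
  have hint : Integrable (Function.uncurry fun (z r : ℝ) =>
      (z : ℂ) ^ m * (K r * Complex.exp (-z * W r)))
      ((volume.restrict (Ioi 0)).prod (volume.restrict (Ioi 0))) := by
    refine ((integrableOn_pow_mul_exp m one_pos).mul_prod hK.norm).mono' ?_ ?_
    · have h1 : AEStronglyMeasurable (fun p : ℝ × ℝ => K p.2)
        ((volume.restrict (Ioi 0)).prod (volume.restrict (Ioi 0))) := hK.1.comp_snd
      have h2 : Measurable fun p : ℝ × ℝ => (p.1 : ℂ) ^ m := by fun_prop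
      have h3 : Measurable fun p : ℝ × ℝ => Complex.exp (-p.1 * W p.2) := by fun_prop
      exact h2.aestronglyMeasurable.mul (h1.mul h3.aestronglyMeasurable)
    · rw [Measure.prod_restrict]
      filter_upwards [ae_restrict_mem (measurableSet_Ioi.prod measurableSet_Ioi)] with p hp
      have hp1 : (0 : ℝ) < p.1 := hp.1
      have hp2 := hW p.2 hp.2
      simp only [Function.uncurry_def, norm_mul, norm_pow, Complex.norm_exp, Complex.norm_real,
        Real.norm_of_nonneg hp1.le]
      rw [mul_comm ‖K p.2‖, ← mul_assoc]
      gcongr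
      simp only [Complex.mul_re, Complex.neg_re, Complex.ofReal_re, Complex.neg_im,
        Complex.ofReal_im]
      nlinarith
  have hswap := integral_integral_swap hint
  have h1 : ∀ z : ℝ, π * (z ^ m * wrightM β z) =
      (∫ r in Ioi (0 : ℝ), (z : ℂ) ^ m * (K r * Complex.exp (-z * W r))).im := by
    intro z
    rw [integral_const_mul, ← Complex.ofReal_pow, Complex.im_ofReal_mul, ← hM]
    ring
  have h2 : π * ∫ z in Ioi (0 : ℝ), z ^ m * wrightM β z =
      (∫ z in Ioi (0 : ℝ), ∫ r in Ioi (0 : ℝ),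
        (z : ℂ) ^ m * (K r * Complex.exp (-z * W r))).im := by
    rw [← integral_const_mul]
    simp_rw [h1]
    exact integral_im hint.integral_prod_left
  have h3 : ∫ r in Ioi (0 : ℝ), ∫ z in Ioi (0 : ℝ),
        (z : ℂ) ^ m * (K r * Complex.exp (-z * W r)) =
      ((m.factorial : ℝ) : ℂ) * ∫ r in Ioi (0 : ℝ), K r * (1 / W r ^ (m + 1)) := by
    rw [← integral_const_mul]
    refine setIntegral_congr_fun measurableSet_Ioi fun r hr => ?_
    have hr1 : 0 < (W r).re := one_pos.trans_le (hW r hr)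
    have h4 : ∀ z : ℝ, (z : ℂ) ^ m * (K r * Complex.exp (-z * W r)) =
      K r * ((z : ℂ) ^ m * Complex.exp (-z * W r)) := fun z => by ring
    simp_rw [h4]
    rw [integral_const_mul, integral_pow_mul_cexp m hr1]
    push_cast
    ring
  rw [hswap, h3, Complex.im_ofReal_mul, hmom] at h2
  have := Real.pi_ne_zero
  rw [div_eq_mul_inv]
  apply mul_left_cancel₀ this
  rw [h2]
  ring

section Uniqueness

variable {Ω : Type*} [MeasurableSpace Ω] {μ : Measure Ω} {ρ X : Ω → ℝ}

lemma integrable_mul_comp_of_le (hρ : Measurable ρ) (hX : Measurable X)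
    (hint : ∀ a, Integrable (fun w => ρ w * Real.exp (a * |X w|)) μ) {u : ℝ → ℂ}
    (hu : Measurable u) {C a : ℝ} (hC : ∀ x, ‖u x‖ ≤ C * Real.exp (a * |x|)) :
    Integrable (fun w => (ρ w : ℂ) * u (X w)) μ := by
  refine ((hint a).norm.const_mul C).mono' (by fun_prop) (Eventually.of_forall fun w => ?_)
  have h1 := mul_le_mul_of_nonneg_left (hC (X w)) (norm_nonneg (ρ w))
  rw [norm_mul, Complex.norm_real, norm_mul, Real.norm_of_nonneg (Real.exp_pos _).le]
  linarith

lemma integrable_map_withDensity (hρ : Measurable ρ) (hX : Measurable X)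
    (hint : ∀ a, Integrable (fun w => ρ w * Real.exp (a * |X w|)) μ) {u : ℝ → ℂ}
    (hu : Measurable u) {C a : ℝ} (hC : ∀ x, ‖u x‖ ≤ C * Real.exp (a * |x|)) :
    Integrable u ((μ.withDensity fun w => ENNReal.ofReal (ρ w)).map X) ∧
      ∫ x, u x ∂((μ.withDensity fun w => ENNReal.ofReal (ρ w)).map X) =
        ∫ w, ((max (ρ w) 0 : ℝ) : ℂ) * u (X w) ∂μ ∧
      Integrable (fun w => ((max (ρ w) 0 : ℝ) : ℂ) * u (X w)) μ := by
  have hm : Measurable fun w => ENNReal.ofReal (ρ w) := by fun_prop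
  have htop : ∀ᵐ w ∂μ, ENNReal.ofReal (ρ w) < ⊤ := by simp
  have hsm : ∀ w, (ENNReal.ofReal (ρ w)).toReal • u (X w) =
      ((max (ρ w) 0 : ℝ) : ℂ) * u (X w) := fun w => by
    rw [ENNReal.toReal_ofReal', Complex.real_smul]
  have hI : Integrable (fun w => ((max (ρ w) 0 : ℝ) : ℂ) * u (X w)) μ := by
    refine (integrable_mul_comp_of_le hρ hX hint hu hC).mono (by fun_prop)
      (Eventually.of_forall fun w => ?_)
    rw [norm_mul, norm_mul, Complex.norm_real, Complex.norm_real]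
    gcongr
    rw [Real.norm_of_nonneg (le_max_right _ _)]
    exact max_le (le_abs_self _) (abs_nonneg _)
  refine ⟨?_, ?_, hI⟩
  · rw [integrable_map_measure hu.aestronglyMeasurable hX.aemeasurable,
      integrable_withDensity_iff_integrable_smul' hm htop]
    simpa only [Function.comp_def, hsm] using hI
  · rw [integral_map hX.aemeasurable hu.aestronglyMeasurable,
      integral_withDensity_eq_integral_toReal_smul hm htop]
    simp only [hsm]

lemma exists_measure_pair (hρ : Measurable ρ) (hX : Measurable X)
    (hint : ∀ a, Integrable (fun w => ρ w * Real.exp (a * |X w|)) μ) :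
    ∃ P N : Measure ℝ, IsFiniteMeasure P ∧ IsFiniteMeasure N ∧
      ∀ (u : ℝ → ℂ) (C a : ℝ), Measurable u → (∀ x, ‖u x‖ ≤ C * Real.exp (a * |x|)) →
        Integrable u P ∧ Integrable u N ∧
          ∫ w, (ρ w : ℂ) * u (X w) ∂μ = ∫ x, u x ∂P - ∫ x, u x ∂N := by
  have hint' : ∀ a, Integrable (fun w => -ρ w * Real.exp (a * |X w|)) μ := fun a => by
    simpa [neg_mul] using (hint a).neg
  have h0 : Integrable ρ μ := by simpa using hint 0
  have i1 := isFiniteMeasure_withDensity_ofReal h0.2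
  have i2 := isFiniteMeasure_withDensity_ofReal h0.neg.2
  refine ⟨(μ.withDensity fun w => ENNReal.ofReal (ρ w)).map X,
    (μ.withDensity fun w => ENNReal.ofReal (-ρ w)).map X, Measure.isFiniteMeasure_map _ _,
    @Measure.isFiniteMeasure_map _ _ _ _ _ i2 _, fun u C a hu hC => ?_⟩
  obtain ⟨h1, h2, h3⟩ := integrable_map_withDensity hρ hX hint hu hC
  obtain ⟨h4, h5, h6⟩ := integrable_map_withDensity hρ.neg hX hint' hu hC
  refine ⟨h1, h4, ?_⟩
  simp only [Pi.neg_apply] at h5 h6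
  rw [h2, h5, ← integral_sub h3 h6]
  refine integral_congr_ae (Eventually.of_forall fun w => ?_)
  simp only
  rw [← sub_mul, ← Complex.ofReal_sub]
  congr 2
  rcases le_total (ρ w) 0 with h | h
  · rw [max_eq_right h, max_eq_left (by linarith)]; ring
  · rw [max_eq_left h, max_eq_right (by linarith)]; ring

lemma hasSum_integral_mul_cexp (hρ : Measurable ρ) (hX : Measurable X)
    (hint : ∀ a, Integrable (fun w => ρ w * Real.exp (a * |X w|)) μ) (s : ℝ) :
    HasSum (fun m : ℕ => (s * Complex.I) ^ m / (m.factorial : ℂ) *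
      ((∫ w, ρ w * X w ^ m ∂μ : ℝ) : ℂ))
      (∫ w, (ρ w : ℂ) * Complex.exp (s * X w * Complex.I) ∂μ) := by
  have hexp : ∀ w, HasSum (fun m : ℕ => |ρ w| * ((|s| * |X w|) ^ m / (m.factorial : ℝ)))
      (|ρ w| * Real.exp (|s| * |X w|)) := by
    intro w
    rw [Real.exp_eq_exp_ℝ]
    exact (NormedSpace.expSeries_div_hasSum_exp (𝔸 := ℝ) _).mul_left _
  have hsum := hasSum_integral_of_dominated_convergence (μ := μ)
    (F := fun (m : ℕ) w => (ρ w : ℂ) * ((s * X w * Complex.I) ^ m / (m.factorial : ℂ)))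
    (f := fun w => (ρ w : ℂ) * Complex.exp (s * X w * Complex.I))
    (fun m w => |ρ w| * ((|s| * |X w|) ^ m / (m.factorial : ℝ)))
    (fun m => by fun_prop)
    (fun m => Eventually.of_forall fun w => by simp)
    (Eventually.of_forall fun w => (hexp w).summable)
    (by
      simp_rw [fun w => (hexp w).tsum_eq]
      simpa [abs_mul] using (hint |s|).abs)
    (Eventually.of_forall fun w => by
      rw [Complex.exp_eq_exp_ℂ]
      exact (NormedSpace.expSeries_div_hasSum_exp (𝔸 := ℂ) _).mul_left _)
  refine (congrArg (fun F => HasSum F _) (funext fun m => ?_)).mpr hsum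
  rw [← integral_complex_ofReal, ← integral_const_mul]
  refine integral_congr_ae (Eventually.of_forall fun w => ?_)
  push_cast
  ring

/-- Densities with finite exponential moments and the same moments have the same integrals. -/
lemma integral_mul_comp_eq_of_moments {Ω' : Type*} [MeasurableSpace Ω'] {ν : Measure Ω'}
    {η Y : Ω' → ℝ} (hρ : Measurable ρ) (hX : Measurable X)
    (hint : ∀ a, Integrable (fun w => ρ w * Real.exp (a * |X w|)) μ)
    (hη : Measurable η) (hY : Measurable Y)
    (hint' : ∀ a, Integrable (fun w => η w * Real.exp (a * |Y w|)) ν)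
    (hmom : ∀ m : ℕ, ∫ w, ρ w * X w ^ m ∂μ = ∫ w, η w * Y w ^ m ∂ν)
    {u : ℝ → ℝ} (hu : Measurable u) {C a : ℝ} (hC : ∀ x, |u x| ≤ C * Real.exp (a * |x|)) :
    ∫ w, ρ w * u (X w) ∂μ = ∫ w, η w * u (Y w) ∂ν := by
  obtain ⟨P, N, _, _, h⟩ := exists_measure_pair hρ hX hint
  obtain ⟨P', N', _, _, h'⟩ := exists_measure_pair hη hY hint'
  have hPN : P + N' = N + P' := by
    refine Measure.ext_of_charFun (funext fun s => ?_)
    have hb : ∀ x : ℝ, ‖Complex.exp (s * x * Complex.I)‖ ≤ 1 * Real.exp (0 * |x|) := fun x => by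
      rw [← Complex.ofReal_mul, Complex.norm_exp_ofReal_mul_I]; simp
    obtain ⟨h1, h2, h3⟩ := h (fun x => Complex.exp (s * x * Complex.I)) 1 0 (by fun_prop) hb
    obtain ⟨h1', h2', h3'⟩ := h' (fun x => Complex.exp (s * x * Complex.I)) 1 0 (by fun_prop) hb
    have hS := (hasSum_integral_mul_cexp hρ hX hint s).tsum_eq
    simp_rw [hmom] at hS
    rw [(hasSum_integral_mul_cexp hη hY hint' s).tsum_eq, h3, h3'] at hS
    rw [charFun_apply_real, charFun_apply_real, integral_add_measure h1 h2',
      integral_add_measure h2 h1']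
    linear_combination -hS
  have hb : ∀ x : ℝ, ‖(u x : ℂ)‖ ≤ C * Real.exp (a * |x|) := fun x => by
    rw [Complex.norm_real]; exact hC x
  obtain ⟨h1, h2, h3⟩ := h (fun x => (u x : ℂ)) C a (by fun_prop) hb
  obtain ⟨h1', h2', h3'⟩ := h' (fun x => (u x : ℂ)) C a (by fun_prop) hb
  have hI : ∫ x, (u x : ℂ) ∂(P + N') = ∫ x, (u x : ℂ) ∂(N + P') := by rw [hPN]
  rw [integral_add_measure h1 h2', integral_add_measure h2 h1'] at hI
  apply Complex.ofReal_injective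
  rw [← integral_complex_ofReal, ← integral_complex_ofReal]
  push_cast
  rw [h3, h3']
  linear_combination hI

end Uniqueness

lemma integrableOn_pow_mul_wrightM_mul_exp {β : ℝ} (hβ0 : 0 < β) (hβ1 : β < 1) (m : ℕ) (b : ℝ) :
    IntegrableOn (fun y => y ^ m * |wrightM β y| * Real.exp (b * y)) (Ioi 0) := by
  obtain ⟨C, hC0, hC⟩ := exists_abs_wrightM_le hβ0 hβ1 (A := |b| + 1) (by positivity)
  have hM := measurable_wrightM β
  refine ((integrableOn_pow_mul_exp m one_pos).const_mul C).mono'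
    (Measurable.aestronglyMeasurable (by fun_prop)) ?_
  filter_upwards [ae_restrict_mem measurableSet_Ioi] with y hy
  have hy0 : (0 : ℝ) < y := hy
  rw [Real.norm_of_nonneg (by positivity)]
  calc y ^ m * |wrightM β y| * Real.exp (b * y)
      ≤ y ^ m * (C * Real.exp (-(|b| + 1) * y)) * Real.exp (|b| * y) := by
        gcongr
        · exact hC y hy0.le
        · exact le_abs_self b
    _ = C * (y ^ m * (Real.exp (-(|b| + 1) * y) * Real.exp (|b| * y))) := by ring
    _ = _ := by rw [← Real.exp_add]; congr 4; ring

lemma integral_wrightG_mul {β τ : ℝ} (hτ : 0 < τ) (h : ℝ → ℝ) :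
    ∫ x in Ioi (0 : ℝ), wrightG β x τ * h x =
      ∫ y in Ioi (0 : ℝ), wrightM β y * h (τ ^ β * y) := by
  have hpos : 0 < τ ^ β := by positivity
  have h1 := integral_comp_mul_left_Ioi (fun x => wrightG β x τ * h x) 0 hpos
  rw [mul_zero, smul_eq_mul, eq_comm, inv_mul_eq_iff_eq_mul₀ hpos.ne'] at h1
  rw [h1, ← integral_const_mul]
  refine integral_congr_ae (Eventually.of_forall fun y => ?_)
  simp only [wrightG_eq]
  rw [mul_div_cancel_left₀ _ hpos.ne', Real.rpow_neg hτ.le]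
  field_simp

lemma hasDerivAt_integral_wrightM_mul {β : ℝ} (hβ0 : 0 < β) (hβ1 : β < 1) {h h' : ℝ → ℝ}
    (hd : ∀ x, 0 < x → HasDerivAt h (h' x) x) (hc : ContinuousOn h' (Ioi 0))
    (he : ExpOrder h) (he' : ExpOrder h') {τ : ℝ} (hτ : 0 < τ) :
    HasDerivAt (fun σ => ∫ y in Ioi (0 : ℝ), wrightM β y * h (σ ^ β * y))
      (∫ y in Ioi (0 : ℝ), wrightM β y * (h' (τ ^ β * y) * (β * τ ^ (β - 1) * y))) τ := by
  obtain ⟨C, a, hC, ha, hb⟩ := he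
  obtain ⟨C', a', hC', ha', hb'⟩ := he'
  have hM := measurable_wrightM β
  have hcont : ContinuousOn h (Ioi 0) := fun x hx => (hd x hx).continuousAt.continuousWithinAt
  have hmeas : ∀ {g : ℝ → ℝ}, ContinuousOn g (Ioi 0) → ∀ {σ : ℝ}, 0 < σ →
      AEStronglyMeasurable (fun y => g (σ ^ β * y)) (volume.restrict (Ioi 0)) := by
    intro g hg σ hσ
    refine ContinuousOn.aestronglyMeasurable ?_ measurableSet_Ioi
    refine hg.comp (by fun_prop) fun y hy => ?_
    have hy0 : (0 : ℝ) < y := hy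
    exact mul_pos (by positivity) hy0
  refine (hasDerivAt_integral_of_dominated_loc_of_deriv_le (s := Ioo (τ / 2) (2 * τ))
    (F' := fun σ y => wrightM β y * (h' (σ ^ β * y) * (β * σ ^ (β - 1) * y)))
    (bound := fun y => C' * β * (τ / 2) ^ (β - 1) *
      (y ^ 1 * |wrightM β y| * Real.exp (a' * (2 * τ) ^ β * y)))
    (Ioo_mem_nhds (by linarith) (by linarith)) ?_ ?_ ?_ ?_ ?_ ?_).2
  · filter_upwards [lt_mem_nhds hτ] with σ hσ
    exact hM.aestronglyMeasurable.mul (hmeas hcont hσ)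
  · refine ((integrableOn_pow_mul_wrightM_mul_exp hβ0 hβ1 0 (a * τ ^ β)).const_mul C).mono'
      (hM.aestronglyMeasurable.mul (hmeas hcont hτ)) ?_
    filter_upwards [ae_restrict_mem measurableSet_Ioi] with y hy
    have hy0 : (0 : ℝ) < y := hy
    have := hb (τ ^ β * y) (by positivity)
    rw [norm_mul, Real.norm_eq_abs, Real.norm_eq_abs]
    calc |wrightM β y| * |h (τ ^ β * y)|
        ≤ |wrightM β y| * (C * Real.exp (a * (τ ^ β * y))) := by gcongr
      _ = _ := by rw [← mul_assoc a]; ring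
  · exact hM.aestronglyMeasurable.mul ((hmeas hc hτ).mul
      (Measurable.aestronglyMeasurable (by fun_prop)))
  · filter_upwards [ae_restrict_mem measurableSet_Ioi] with y hy σ hσ
    have hy0 : (0 : ℝ) < y := hy
    have hσ1 : τ / 2 < σ := hσ.1
    have hσ2 : σ < 2 * τ := hσ.2
    have hσ0 : 0 < σ := by linarith
    have := hb' (σ ^ β * y) (by positivity)
    have hmono : σ ^ (β - 1) ≤ (τ / 2) ^ (β - 1) :=
      Real.rpow_le_rpow_of_nonpos (by positivity) hσ1.le (by linarith)
    rw [norm_mul, norm_mul, Real.norm_eq_abs, Real.norm_eq_abs,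
      Real.norm_of_nonneg (by positivity : 0 ≤ β * σ ^ (β - 1) * y)]
    calc |wrightM β y| * (|h' (σ ^ β * y)| * (β * σ ^ (β - 1) * y))
        ≤ |wrightM β y| * (C' * Real.exp (a' * ((2 * τ) ^ β * y)) *
          (β * (τ / 2) ^ (β - 1) * y)) := by
          gcongr
          refine this.trans ?_
          gcongr
      _ = _ := by rw [← mul_assoc a']; ring
  · exact (integrableOn_pow_mul_wrightM_mul_exp hβ0 hβ1 1 _).const_mul _
  · filter_upwards [ae_restrict_mem measurableSet_Ioi] with y hy σ hσ
    have hy0 : (0 : ℝ) < y := hy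
    have hσ1 : τ / 2 < σ := hσ.1
    have hσ0 : 0 < σ := by linarith
    have h1 := (Real.hasDerivAt_rpow_const (p := β) (Or.inl hσ0.ne')).mul_const y
    exact ((hd (σ ^ β * y) (by positivity)).comp σ h1).const_mul _

lemma setIntegral_rpow_mul_rpow {p q t : ℝ} (hp : 0 < p) (hq : 0 < q) (ht : 0 < t) :
    ∫ x in Ioc 0 t, x ^ (p - 1) * (t - x) ^ (q - 1) =
      t ^ (p + q - 1) * (Real.Gamma p * Real.Gamma q / Real.Gamma (p + q)) := by
  have h := Complex.betaIntegral_scaled p q ht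
  have hbeta : Complex.betaIntegral p q =
      ((Real.Gamma p * Real.Gamma q / Real.Gamma (p + q) : ℝ) : ℂ) := by
    have h1 := Complex.Gamma_mul_Gamma_eq_betaIntegral (s := p) (t := q) (by simpa) (by simpa)
    have h2 : Complex.Gamma (p + q) ≠ 0 := Complex.Gamma_ne_zero_of_re_pos (by simp; positivity)
    push_cast [Complex.Gamma_ofReal]
    rw [← Complex.Gamma_ofReal, ← Complex.Gamma_ofReal, ← Complex.Gamma_ofReal]
    push_cast
    rw [h1]
    field_simp
  rw [hbeta, intervalIntegral.integral_of_le ht.le] at h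
  apply Complex.ofReal_injective
  rw [← integral_complex_ofReal]
  convert h using 1
  · refine setIntegral_congr_fun measurableSet_Ioc fun x hx => ?_
    have h1 : 0 ≤ x := hx.1.le
    have h2 : 0 ≤ t - x := sub_nonneg.2 hx.2
    push_cast [Complex.ofReal_cpow h1, Complex.ofReal_cpow h2]
    rfl
  · push_cast [Complex.ofReal_cpow ht.le]
    rfl

lemma integrableOn_rpow_mul_rpow {p q t : ℝ} (hp : 0 < p) (hq : 0 < q) (ht : 0 < t) :
    IntegrableOn (fun x => x ^ (p - 1) * (t - x) ^ (q - 1)) (Ioc 0 t) := by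
  by_contra h
  have h1 := integral_undef h
  rw [setIntegral_rpow_mul_rpow hp hq ht] at h1
  have := Real.Gamma_pos_of_pos hp
  have := Real.Gamma_pos_of_pos hq
  have := Real.Gamma_pos_of_pos (add_pos hp hq)
  exact absurd h1 (by positivity)

/-- The Caputo derivative of a Wright-type transform is the transform of the derivative. -/
lemma caputo_wrightTransform {β : ℝ} (hβ0 : 0 < β) (hβ1 : β < 1) {T h h' : ℝ → ℝ}
    (hT : ∀ τ, 0 < τ → T τ = ∫ x in Ioi (0 : ℝ), wrightG β x τ * h x)
    (hd : ∀ x, 0 < x → HasDerivAt h (h' x) x) (hc : ContinuousOn h' (Ioi 0))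
    (he : ExpOrder h) (he' : ExpOrder h') {t : ℝ} (ht : 0 < t) :
    caputo β T t = ∫ x in Ioi (0 : ℝ), wrightG β x t * h' x := by
  have hderiv : ∀ τ, 0 < τ → deriv T τ =
      ∫ y in Ioi (0 : ℝ), wrightM β y * (h' (τ ^ β * y) * (β * τ ^ (β - 1) * y)) := by
    intro τ hτ
    refine ((hasDerivAt_integral_wrightM_mul hβ0 hβ1 hd hc he he' hτ).congr_of_eventuallyEq
      ?_).deriv
    filter_upwards [lt_mem_nhds hτ] with σ hσ
    rw [hT σ hσ, integral_wrightG_mul hσ]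
  obtain ⟨C, a, hC, ha, hb⟩ := he'
  have hG : 0 < Real.Gamma (1 - β) := Real.Gamma_pos_of_pos (by linarith)
  have hM := measurable_wrightM β
  have hM0 := fun m b => integrableOn_pow_mul_wrightM_mul_exp hβ0 hβ1 m b
  set c : ℝ := β / Real.Gamma (1 - β) with hcdef
  set μ : Measure (ℝ × ℝ) := (volume.restrict (Ioc 0 t)).prod (volume.restrict (Ioi 0)) with hμ
  set ρ : ℝ × ℝ → ℝ := fun p => (c * (p.1 ^ (β - 1) * (t - p.1) ^ (1 - β - 1))) *
    (p.2 * wrightM β p.2) with hρdef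
  set X : ℝ × ℝ → ℝ := fun p => p.1 ^ β * p.2 with hXdef
  set u : ℝ → ℝ := (Ioi 0).indicator h' with hudef
  have hρ : Measurable ρ := by fun_prop
  have hX : Measurable X := by fun_prop
  have hu : Measurable u := by
    rw [hudef, ← piecewise_eq_indicator]
    exact hc.measurable_piecewise continuousOn_const measurableSet_Ioi
  have hub : ∀ x, |u x| ≤ C * Real.exp (a * |x|) := by
    intro x
    by_cases hx : 0 < x
    · rw [hudef, indicator_of_mem (by exact hx), abs_of_pos hx]
      exact hb x hx.le
    · rw [hudef, indicator_of_notMem (by exact hx), abs_zero]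
      positivity
  have hint : ∀ b, Integrable (fun p => ρ p * Real.exp (b * |X p|)) μ := by
    intro b
    have h1 := ((integrableOn_rpow_mul_rpow hβ0 (by linarith : 0 < 1 - β) ht).const_mul c).norm
    refine (h1.mul_prod (hM0 1 (|b| * t ^ β))).mono' (by fun_prop) ?_
    rw [Measure.prod_restrict]
    filter_upwards [ae_restrict_mem (measurableSet_Ioc.prod measurableSet_Ioi)] with p hp
    have hp1 : 0 < p.1 := hp.1.1
    have hp2 : p.1 ≤ t := hp.1.2
    have hp3 : (0 : ℝ) < p.2 := hp.2
    rw [hρdef, hXdef]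
    simp only
    rw [norm_mul, norm_mul, mul_assoc, norm_mul p.2, Real.norm_of_nonneg hp3.le, pow_one,
      Real.norm_of_nonneg (Real.exp_pos _).le, Real.norm_eq_abs (wrightM β p.2)]
    gcongr ‖_‖ * (p.2 * |_| * Real.exp ?_)
    rw [abs_of_pos (by positivity), mul_assoc]
    calc b * (p.1 ^ β * p.2) ≤ |b| * (p.1 ^ β * p.2) := by gcongr; exact le_abs_self b
      _ ≤ |b| * (t ^ β * p.2) := by gcongr
  have hint' : ∀ b, Integrable (fun y => wrightM β y * Real.exp (b * |t ^ β * y|))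
      (volume.restrict (Ioi 0)) := by
    intro b
    refine (hM0 0 (b * t ^ β)).mono' (Measurable.aestronglyMeasurable (by fun_prop)) ?_
    filter_upwards [ae_restrict_mem measurableSet_Ioi] with y hy
    have hy0 : (0 : ℝ) < y := hy
    rw [norm_mul, Real.norm_of_nonneg (Real.exp_pos _).le, Real.norm_eq_abs,
      abs_of_pos (by positivity : 0 < t ^ β * y), pow_zero, one_mul, mul_assoc]
  have hmom : ∀ m : ℕ, ∫ p, ρ p * X p ^ m ∂μ =
      ∫ y in Ioi (0 : ℝ), wrightM β y * (t ^ β * y) ^ m := by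
    intro m
    have hp : 0 < β * (m + 1) := by positivity
    have h1 : ∫ p, ρ p * X p ^ m ∂μ =
        ∫ p, (c * (p.1 ^ (β * (m + 1) - 1) * (t - p.1) ^ (1 - β - 1))) *
          (p.2 ^ (m + 1) * wrightM β p.2) ∂μ := by
      refine integral_congr_ae ?_
      rw [hμ, Measure.prod_restrict]
      filter_upwards [ae_restrict_mem (measurableSet_Ioc.prod measurableSet_Ioi)] with p hp
      have hp1 : 0 < p.1 := hp.1.1
      rw [hρdef, hXdef]
      simp only
      rw [show β * ((m : ℝ) + 1) - 1 = (β - 1) + β * m by ring, Real.rpow_add hp1,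
        Real.rpow_mul_natCast hp1.le]
      ring
    have h2 : ∫ y in Ioi (0 : ℝ), wrightM β y * (t ^ β * y) ^ m =
        (t ^ β) ^ m * ∫ y in Ioi (0 : ℝ), y ^ m * wrightM β y := by
      rw [← integral_const_mul]
      congr 1 with y
      ring
    have hGa := Real.Gamma_add_one hp.ne'
    have hGp := Real.Gamma_pos_of_pos hp
    have hGq : 0 < Real.Gamma (1 + β * m) := Real.Gamma_pos_of_pos (by positivity)
    rw [h1, h2, hμ, integral_prod_mul (fun x => c * (x ^ (β * (m + 1) - 1) * (t - x) ^ (1 - β - 1)))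
      (fun y => y ^ (m + 1) * wrightM β y), integral_const_mul,
      setIntegral_rpow_mul_rpow hp (by linarith) ht, integral_pow_mul_wrightM hβ0 hβ1,
      integral_pow_mul_wrightM hβ0 hβ1, ← Real.rpow_mul_natCast ht.le,
      show β * ((m : ℝ) + 1) + (1 - β) - 1 = β * m by ring,
      show β * ((m : ℝ) + 1) + (1 - β) = 1 + β * m by ring, Nat.factorial_succ]
    push_cast
    rw [add_comm 1 (β * ((m : ℝ) + 1)), hGa, hcdef]
    field_simp
  have hmain := integral_mul_comp_eq_of_moments hρ hX hint hM (by fun_prop) hint' hmom hu hub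
  have hIu : Integrable (fun p => ρ p * u (X p)) μ := by
    have := (integrable_mul_comp_of_le hρ hX hint (u := fun x => (u x : ℂ)) (by fun_prop)
      (C := C) (a := a) (fun x => by rw [Complex.norm_real]; exact hub x)).re
    simpa using this
  have hrhs : ∫ x in Ioi (0 : ℝ), wrightG β x t * h' x =
      ∫ y in Ioi (0 : ℝ), wrightM β y * u (t ^ β * y) := by
    rw [integral_wrightG_mul ht]
    refine setIntegral_congr_fun measurableSet_Ioi fun y hy => ?_
    have hy0 : (0 : ℝ) < y := hy
    rw [hudef, indicator_of_mem (by exact mul_pos (by positivity) hy0)]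
  rw [hrhs, ← hmain, hμ, integral_prod _ hIu, caputo, intervalIntegral.integral_of_le ht.le,
    ← integral_const_mul]
  refine setIntegral_congr_fun measurableSet_Ioc fun τ hτ => ?_
  have hτ0 : 0 < τ := hτ.1
  rw [hderiv τ hτ0, ← mul_assoc, ← integral_const_mul]
  refine setIntegral_congr_fun measurableSet_Ioi fun y hy => ?_
  have hy0 : (0 : ℝ) < y := hy
  have hmem : τ ^ β * y ∈ Ioi (0 : ℝ) := mul_pos (by positivity) hy0
  simp only [hρdef, hXdef, hudef, hcdef, indicator_of_mem hmem]
  rw [show 1 - β - 1 = -β by ring]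
  ring

lemma iterate_caputo_wrightTransform {β : ℝ} (hβ0 : 0 < β) (hβ1 : β < 1) {n : ℕ} {f : ℝ → ℝ}
    (hf : ContDiffOn ℝ n f (Ici 0)) (hfe : ∀ k ≤ n, ExpOrder (iteratedDeriv k f)) {T : ℝ → ℝ}
    (hT : ∀ τ, 0 < τ → T τ = ∫ x in Ioi (0 : ℝ), wrightG β x τ * f x) {k : ℕ} (hk : k ≤ n)
    {t : ℝ} (ht : 0 < t) :
    (caputo β)^[k] T t = ∫ x in Ioi (0 : ℝ), wrightG β x t * iteratedDeriv k f x := by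
  have hf' : ContDiffOn ℝ n f (Ioi 0) := hf.mono Ioi_subset_Ici_self
  have heq : ∀ j, EqOn (iteratedDerivWithin j f (Ioi 0)) (iteratedDeriv j f) (Ioi 0) :=
    fun j => iteratedDerivWithin_of_isOpen isOpen_Ioi
  induction k generalizing t with
  | zero => simpa using hT t ht
  | succ k ih =>
    rw [Function.iterate_succ_apply']
    refine caputo_wrightTransform hβ0 hβ1 (fun τ hτ => ih (by lia) hτ) (fun x hx => ?_) ?_
      (hfe k (by lia)) (hfe (k + 1) hk) ht
    · have h1 := (hf'.differentiableOn_iteratedDerivWithin (m := k) (by exact_mod_cast hk)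
        (uniqueDiffOn_Ioi 0)).congr fun y hy => (heq k hy).symm
      have h2 := (h1.differentiableAt (Ioi_mem_nhds hx)).hasDerivAt
      rwa [← iteratedDeriv_succ] at h2
    · exact (hf'.continuousOn_iteratedDerivWithin (m := (k + 1 : ℕ)) (by exact_mod_cast hk)
        (uniqueDiffOn_Ioi 0)).congr fun y hy => (heq (k + 1) hy).symm

/-- For `f ∈ Cⁿ([0,∞))` with all derivatives up to order `n` of exponential
order, and assuming the matching initial conditions `(D_c^β)^k f_β(0⁺) = f^{(k)}(0)` for
`k = 0,…,n−1`, the `n`-fold iterated Caputo derivative of the Wright-type transform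
satisfies `(D_c^β)^n f_β(t) = ∫_0^∞ f^{(n)}(x) g_β(x;t) dx` for every `t > 0`. -/
theorem iterated_caputo_wrightTransform (β : ℝ) (hβ0 : 0 < β) (hβ1 : β < 1)
    (n : ℕ) (hn : 1 ≤ n) (f : ℝ → ℝ) (hf : ContDiffOn ℝ n f (Set.Ici 0))
    (hfe : ∀ k ≤ n, ExpOrder (iteratedDeriv k f))
    (fβ : ℝ → ℝ)
    (hfβ : ∀ τ : ℝ, 0 < τ → fβ τ = ∫ x in Set.Ioi (0:ℝ), wrightG β x τ * f x)
    (hmatch : ∀ k < n, Filter.Tendsto ((caputo β)^[k] fβ)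
      (nhdsWithin 0 (Set.Ioi 0)) (nhds (iteratedDeriv k f 0)))
    (t : ℝ) (ht : 0 < t) :
    (caputo β)^[n] fβ t = ∫ x in Set.Ioi (0:ℝ), iteratedDeriv n f x * wrightG β x t := by
  rw [iterate_caputo_wrightTransform hβ0 hβ1 hf hfe hfβ le_rfl ht]
  simp only [mul_comm]
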